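/- Let 0 < a ≤ 1 and let ω, σ be weight functions (continuous, increasing, vanishing on [0,1], with φ_ω(t) := ω(e^t) and φ_σ(t) := σ(e^t) convex). If ω(t^{1/a}) = o(σ(t)) as t → ∞, then for all λ, μ > 0 there exists C > 0 such that λ φ_σ*(j/λ) ≤ C + μ a φ_ω*(j/μ) for all j ∈ ℕ₀. -/

import Mathlib

/-- A monotone weight whose Young conjugate is finite at `1` is eventually positive. -/
lemma eventually_pos_of_bddAbove_conjugate {sig : ℝ → ℝ} {M : ℝ}
    (hmono : MonotoneOn sig (Set.Ici 0))
    (hM : ∀ t, 0 ≤ t → t - sig (Real.exp t) ≤ M) :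
    ∀ᶠ x in Filter.atTop, 0 < sig x := by
  set T : ℝ := |M| + 1
  have hT : 0 < sig (Real.exp T) := by
    have h1 := hM T (by positivity)
    have h2 := le_abs_self M
    have h3 : T = |M| + 1 := rfl
    linarith
  filter_upwards [Filter.eventually_ge_atTop (Real.exp T)] with x hx
  exact hT.trans_le
    (hmono (Set.mem_Ici.2 (Real.exp_pos T).le) (Set.mem_Ici.2 ((Real.exp_pos T).le.trans hx)) hx)

/-- If `omg (x ^ (1 / a)) = o(sig x)`, then `omg (exp (t / a))` is bounded by any positive multiple
of `sig (exp t)` up to an additive constant. -/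
lemma exists_le_add_mul_of_tendsto_div {omg sig : ℝ → ℝ} {a ε : ℝ} (ha : 0 < a) (hε : 0 < ε)
    (hmono : MonotoneOn omg (Set.Ici 0)) (hnonneg : ∀ t, 0 ≤ t → 0 ≤ omg t)
    (hsig : ∀ t, 0 ≤ t → 0 ≤ sig t) (hpos : ∀ᶠ x in Filter.atTop, 0 < sig x)
    (hsmall : Filter.Tendsto (fun t : ℝ => omg (t ^ (1 / a)) / sig t) Filter.atTop (nhds 0)) :
    ∃ K : ℝ, 0 ≤ K ∧ ∀ t, omg (Real.exp (t / a)) ≤ K + ε * sig (Real.exp t) := by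
  obtain ⟨T, hT⟩ := Filter.eventually_atTop.1
    (Real.tendsto_exp_atTop.eventually (hpos.and (hsmall.eventually_lt_const hε)))
  have hK : 0 ≤ omg (Real.exp (T / a)) := hnonneg _ (Real.exp_pos _).le
  refine ⟨omg (Real.exp (T / a)), hK, fun t => ?_⟩
  rcases le_total T t with h | h
  · obtain ⟨hs, hlt⟩ := hT t h
    rw [← Real.exp_mul, mul_one_div, div_lt_iff₀ hs] at hlt
    linarith
  · have hle : omg (Real.exp (t / a)) ≤ omg (Real.exp (T / a)) :=
      hmono (Set.mem_Ici.2 (Real.exp_pos _).le) (Set.mem_Ici.2 (Real.exp_pos _).le)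
        (Real.exp_le_exp.2 (by gcongr))
    have := mul_nonneg hε.le (hsig _ (Real.exp_pos t).le)
    linarith

theorem stmt_7 (omg phiom sig phisig : ℝ → ℝ)
    (hcont : ContinuousOn omg (Set.Ici 0))
    (hmono : MonotoneOn omg (Set.Ici 0))
    (hnonneg : ∀ t, 0 ≤ t → 0 ≤ omg t)
    (hzero : ∀ t ∈ Set.Icc (0:ℝ) 1, omg t = 0)
    (hconv : ConvexOn ℝ (Set.Ici 0) (fun t => omg (Real.exp t)))
    (hphiom : ∀ s : ℝ, 0 ≤ s →
      IsLUB {y : ℝ | ∃ t : ℝ, 0 ≤ t ∧ y = s * t - omg (Real.exp t)} (phiom s))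
    (hcont : ContinuousOn sig (Set.Ici 0))
    (hmono : MonotoneOn sig (Set.Ici 0))
    (hnonneg : ∀ t, 0 ≤ t → 0 ≤ sig t)
    (hzero : ∀ t ∈ Set.Icc (0:ℝ) 1, sig t = 0)
    (hconv : ConvexOn ℝ (Set.Ici 0) (fun t => sig (Real.exp t)))
    (hphisig : ∀ s : ℝ, 0 ≤ s →
      IsLUB {y : ℝ | ∃ t : ℝ, 0 ≤ t ∧ y = s * t - sig (Real.exp t)} (phisig s))
    (a : ℝ) (ha0 : 0 < a) (ha1 : a ≤ 1)
    (hsmall : Filter.Tendsto (fun t : ℝ => omg (t ^ (1 / a)) / sig t) Filter.atTop (nhds 0)) :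
    ∀ lam : ℝ, 0 < lam → ∀ mu : ℝ, 0 < mu → ∃ C : ℝ, 0 < C ∧
      ∀ j : ℕ, lam * phisig ((j : ℝ) / lam) ≤ C + mu * a * phiom ((j : ℝ) / mu) := by
  have homono : MonotoneOn omg (Set.Ici 0) := by assumption
  have honn : ∀ t, 0 ≤ t → 0 ≤ omg t := by assumption
  intro lam hlam mu hmu
  have hpos : ∀ᶠ x in Filter.atTop, 0 < sig x :=
    eventually_pos_of_bddAbove_conjugate hmono fun t ht =>
      (hphisig 1 zero_le_one).1 ⟨t, ht, by ring⟩
  obtain ⟨K, hK, hle⟩ := exists_le_add_mul_of_tendsto_div ha0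
    (show 0 < lam / (mu * a) by positivity) homono honn hnonneg hpos hsmall
  refine ⟨mu * a * K + 1, by positivity, fun j => ?_⟩
  rw [← le_div_iff₀' hlam]
  refine (hphisig _ (by positivity)).2 ?_
  rintro _ ⟨t, ht, rfl⟩
  rw [le_div_iff₀' hlam]
  have hom := (hphiom (j / mu) (by positivity)).1 ⟨t / a, by positivity, rfl⟩
  have h1 := mul_le_mul_of_nonneg_left hom (show 0 ≤ mu * a by positivity)
  have h2 := mul_le_mul_of_nonneg_left (hle t) (show 0 ≤ mu * a by positivity)
  have e1 : mu * a * (j / mu * (t / a) - omg (Real.exp (t / a)))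
      = j * t - mu * a * omg (Real.exp (t / a)) := by field_simp
  have e2 : mu * a * (K + lam / (mu * a) * sig (Real.exp t))
      = mu * a * K + lam * sig (Real.exp t) := by field_simp
  have e3 : lam * (j / lam * t - sig (Real.exp t)) = j * t - lam * sig (Real.exp t) := by
    field_simp
  linarith
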